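/- arXiv:2311.05140 — 2 statements merged into one kernel-verified Lean document; each statement's English description precedes it below -/
import Mathlib

section
/- Fix r₀>0 and A₀≥1. Consider pairs (Y,p) where Y is a connected subset with basepoint p of a length space (M,d) such that the closure of the r₀-neighborhood B_{r₀}(Y,M)={z∈M : d(z,Y)<r₀} in M is complete and M carries a Borel measure that is (r₀,A₀)-doubling along Y. (1) For each 0<r<r₀, the family of pointed metric spaces (Y, d_{B_r(Y,M)}|_Y, p) — Y equipped with the r-extrinsic metric, i.e. the restriction to Y of the induced length metric of the open r-neighborhood B_r(Y,M) — is uniformly totally bounded, hence precompact in the pointed Gromov–Hausdorff topology. (2) If moreover diam(Y,d_Y) ≤ D for a fixed D>0 (d_Y the induced length metric on Y), then the same conclusion holds for r = r₀. -/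
open Set Metric Filter MeasureTheory ENNReal NNReal

noncomputable section

/-- The infimum of lengths (total variations) of continuous paths from `x` to `y`
with image contained in `S`: the induced length (extended) distance on `S`. -/
def lengthEDistIn {X : Type*} [PseudoEMetricSpace X] (S : Set X) (x y : X) : ℝ≥0∞ :=
  ⨅ (γ : ℝ → X) (_ : ContinuousOn γ (Set.Icc 0 1)) (_ : γ 0 = x) (_ : γ 1 = y)
    (_ : Set.MapsTo γ (Set.Icc 0 1) S), eVariationOn γ (Set.Icc 0 1)

/-- A metric space is a length space if the distance between any two points is the
infimum of lengths of continuous paths joining them. -/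
def IsLengthSpace (X : Type*) [MetricSpace X] : Prop :=
  ∀ x y : X, edist x y = lengthEDistIn (Set.univ : Set X) x y

/-- `(ρ, A₀)`-locally doubling Borel measure. -/
def LocallyDoubling {X : Type*} [MetricSpace X] [MeasurableSpace X]
    (μ : Measure X) (ρ : ℝ) (A₀ : ℝ≥0) : Prop :=
  ∀ (x : X) (r : ℝ), 0 < r → r ≤ ρ →
    0 < μ (Metric.ball x r) ∧
    μ (Metric.ball x r) ≤ (A₀ : ℝ≥0∞) * μ (Metric.ball x (r / 2)) ∧
    (A₀ : ℝ≥0∞) * μ (Metric.ball x (r / 2)) < ⊤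

/-- The measure `μ` is `(r₀, A₀)`-doubling along `Y`: the doubling condition holds for
all balls of radius `≤ r₀` centered in the open `r₀`-neighborhood of `Y`. -/
def DoublingAlong {X : Type*} [MetricSpace X] [MeasurableSpace X]
    (μ : Measure X) (Y : Set X) (r₀ : ℝ) (A₀ : ℝ≥0) : Prop :=
  ∀ x : X, (∃ w ∈ Y, dist x w < r₀) → ∀ r : ℝ, 0 < r → r ≤ r₀ →
    0 < μ (Metric.ball x r) ∧
    μ (Metric.ball x r) ≤ (A₀ : ℝ≥0∞) * μ (Metric.ball x (r / 2)) ∧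
    (A₀ : ℝ≥0∞) * μ (Metric.ball x (r / 2)) < ⊤

lemma aux_pack (r₀ : ℝ) (hr₀ : 0 < r₀) (A₀ : ℝ≥0) (hA₀ : 1 ≤ A₀) (δ : ℝ) (hδ : 0 < δ) :
    ∃ C : ℕ, ∀ (M : Type) [MetricSpace M] [MeasurableSpace M] [BorelSpace M]
      (μ : Measure M) (Y : Set M), DoublingAlong μ Y r₀ A₀ →
      ∀ x : M, (∃ w ∈ Y, dist x w < r₀) → ∀ F : Finset M,
        (∀ z ∈ F, (∃ w ∈ Y, dist z w < r₀) ∧ dist z x < r₀ / 4) →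
        (∀ z ∈ F, ∀ z' ∈ F, z ≠ z' → δ ≤ dist z z') → F.card ≤ C := by
  obtain ⟨k, hk⟩ : ∃ k : ℕ, r₀ / 2 ^ k ≤ min (δ / 2) (r₀ / 4) := by
    have hm : 0 < min (δ / 2) (r₀ / 4) := by positivity
    obtain ⟨k, hk⟩ := exists_pow_lt_of_lt_one (div_pos hm hr₀) (by norm_num : (1 / 2 : ℝ) < 1)
    refine ⟨k, ?_⟩
    rw [lt_div_iff₀ hr₀] at hk
    have : r₀ / 2 ^ k = (1 / 2) ^ k * r₀ := by rw [one_div, inv_pow]; field_simp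
    rw [this]; exact hk.le
  have hk1 : r₀ / 2 ^ k ≤ δ / 2 := hk.trans (min_le_left _ _)
  have hk2 : r₀ / 2 ^ k ≤ r₀ / 4 := hk.trans (min_le_right _ _)
  refine ⟨⌈A₀ ^ k⌉₊, ?_⟩
  intro M _ _ _ μ Y hμ x hx F hF hsep
  have iter : ∀ z : M, (∃ w ∈ Y, dist z w < r₀) → ∀ j : ℕ,
      μ (ball z r₀) ≤ (A₀ : ℝ≥0∞) ^ j * μ (ball z (r₀ / 2 ^ j)) := by
    intro z hz j
    induction j with
    | zero => simp
    | succ j ih =>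
      have h1 := (hμ z hz (r₀ / 2 ^ j) (by positivity)
        (div_le_self hr₀.le (one_le_pow₀ (by norm_num)))).2.1
      have h2 : r₀ / 2 ^ j / 2 = r₀ / 2 ^ (j + 1) := by rw [pow_succ]; field_simp
      rw [h2] at h1
      calc _ ≤ _ := ih
        _ ≤ (A₀ : ℝ≥0∞) ^ j * (A₀ * μ (ball z (r₀ / 2 ^ (j + 1)))) := by gcongr
        _ = _ := by rw [pow_succ (A₀ : ℝ≥0∞), mul_assoc]
  set m := μ (ball x (r₀ / 2)) with hm
  have hm0 : m ≠ 0 := (hμ x hx (r₀ / 2) (by positivity) (by linarith)).1.ne'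
  have hmt : m ≠ ⊤ := by
    have h := (hμ x hx r₀ hr₀ le_rfl).2.2
    refine ne_top_of_le_ne_top h.ne ?_
    have : (1 : ℝ≥0∞) ≤ A₀ := by exact_mod_cast hA₀
    calc m = 1 * m := (one_mul _).symm
      _ ≤ _ := by gcongr
  have hlow : ∀ z ∈ F, m ≤ (A₀ : ℝ≥0∞) ^ k * μ (ball z (r₀ / 2 ^ k)) := by
    intro z hz
    refine le_trans (measure_mono ?_) (iter z (hF z hz).1 k)
    apply ball_subset_ball'
    rw [dist_comm]; linarith [(hF z hz).2]
  have hsum : ∑ z ∈ F, μ (ball z (r₀ / 2 ^ k)) ≤ m := by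
    rw [← measure_biUnion_finset]
    · refine measure_mono (iUnion₂_subset fun z hz => ball_subset_ball' ?_)
      linarith [(hF z hz).2]
    · intro z hz z' hz' hne
      exact ball_disjoint_ball (by linarith [hsep z hz z' hz' hne])
    · intro z _; exact measurableSet_ball
  have hfin : (F.card : ℝ≥0∞) * m ≤ (A₀ : ℝ≥0∞) ^ k * m := by
    calc (F.card : ℝ≥0∞) * m = ∑ z ∈ F, m := by simp
      _ ≤ ∑ z ∈ F, (A₀ : ℝ≥0∞) ^ k * μ (ball z (r₀ / 2 ^ k)) := Finset.sum_le_sum hlow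
      _ = (A₀ : ℝ≥0∞) ^ k * ∑ z ∈ F, μ (ball z (r₀ / 2 ^ k)) := by rw [Finset.mul_sum]
      _ ≤ _ := by gcongr
  rw [ENNReal.mul_le_mul_iff_left hm0 hmt] at hfin
  have h3 : (F.card : ℝ≥0) ≤ A₀ ^ k := by exact_mod_cast hfin
  exact_mod_cast h3.trans (Nat.le_ceil _)

lemma aux_net {M : Type} [MetricSpace M] (S : Set M) (δ : ℝ) (hδ : 0 < δ) (C : ℕ)
    (h : ∀ F : Finset M, ↑F ⊆ S → (∀ z ∈ F, ∀ z' ∈ F, z ≠ z' → δ ≤ dist z z') → F.card ≤ C) :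
    ∃ F : Finset M, ↑F ⊆ S ∧ F.card ≤ C ∧ ∀ x ∈ S, ∃ y ∈ F, dist x y < δ := by
  classical
  by_contra hcon
  push Not at hcon
  have key : ∀ n : ℕ, n ≤ C + 1 → ∃ F : Finset M, ↑F ⊆ S ∧
      (∀ z ∈ F, ∀ z' ∈ F, z ≠ z' → δ ≤ dist z z') ∧ F.card = n := by
    intro n
    induction n with
    | zero => intro _; exact ⟨∅, by simp⟩
    | succ n ih =>
      intro hn
      obtain ⟨F, hFS, hsep, hc⟩ := ih (by omega)
      obtain ⟨x, hxS, hx⟩ := hcon F hFS (by omega)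
      have hxF : x ∉ F := fun hxF => by
        have := hx x hxF
        rw [dist_self] at this
        linarith
      refine ⟨insert x F, ?_, ?_, ?_⟩
      · intro y hy
        rcases Finset.mem_insert.1 (Finset.mem_coe.1 hy) with rfl | hy
        · exact hxS
        · exact hFS hy
      · intro z hz z' hz' hne
        rcases Finset.mem_insert.1 hz with rfl | hzF <;>
          rcases Finset.mem_insert.1 hz' with rfl | hzF'
        · exact absurd rfl hne
        · exact hx z' hzF'
        · rw [dist_comm]; exact hx z hzF
        · exact hsep z hzF z' hzF' hne
      · rw [Finset.card_insert_of_notMem hxF, hc]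
  obtain ⟨F, hFS, hsep, hc⟩ := key (C + 1) le_rfl
  have := h F hFS hsep
  omega

lemma aux_path {M : Type} [MetricSpace M] {S : Set M} {x y : M} {L : ℝ≥0∞}
    (h : lengthEDistIn S x y < L) :
    ∃ γ : ℝ → M, ContinuousOn γ (Set.Icc 0 1) ∧ γ 0 = x ∧ γ 1 = y ∧
      Set.MapsTo γ (Set.Icc 0 1) S ∧ eVariationOn γ (Set.Icc 0 1) < L := by
  unfold lengthEDistIn at h
  simp only [iInf_lt_iff] at h
  obtain ⟨γ, h1, h2, h3, h4, h5⟩ := h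
  exact ⟨γ, h1, h2, h3, h4, h5⟩

lemma aux_local {M : Type} [MetricSpace M] (hM : IsLengthSpace M) (Y : Set M) (r ε : ℝ)
    {x y : M} (hx : x ∈ Y) (h : dist x y < min ε r) :
    lengthEDistIn {z : M | ∃ y ∈ Y, dist z y < r} x y < ENNReal.ofReal ε := by
  have hpos : 0 < min ε r := dist_nonneg.trans_lt h
  have h' : lengthEDistIn (Set.univ : Set M) x y < ENNReal.ofReal (min ε r) := by
    rw [← hM x y, edist_dist]
    exact (ENNReal.ofReal_lt_ofReal_iff hpos).2 h
  obtain ⟨γ, hc, h0, h1, -, hv⟩ := aux_path h'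
  refine lt_of_le_of_lt ?_ (hv.trans_le (ENNReal.ofReal_le_ofReal (min_le_left _ _)))
  refine iInf_le_of_le γ (iInf_le_of_le hc (iInf_le_of_le h0 (iInf_le_of_le h1
    (iInf_le_of_le ?_ le_rfl))))
  intro t ht
  refine ⟨x, hx, ?_⟩
  have h2 : edist (γ t) (γ 0) ≤ eVariationOn γ (Set.Icc 0 1) :=
    eVariationOn.edist_le γ ht (by simp)
  have h3 := h2.trans_lt hv
  rw [h0, edist_dist, ENNReal.ofReal_lt_ofReal_iff hpos] at h3
  exact h3.trans_le (min_le_right _ _)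

lemma aux_chain {M : Type} [MetricSpace M] (U : Set M) (h : ℝ) (hh : 0 < h) (C : ℕ) (p : M)
    (hp : p ∈ U)
    (hC : ∀ c ∈ U, ∃ G : Finset M, ↑G ⊆ U ∧ G.card ≤ C ∧
      ∀ z ∈ U, dist z c < 2 * h → ∃ y ∈ G, dist z y < h) (k : ℕ) :
    ∃ F : Finset M, ↑F ⊆ U ∧ F.card ≤ (1 + C) ^ k ∧
      ∀ γ : ℝ → M, ContinuousOn γ (Set.Icc 0 1) → γ 0 = p → Set.MapsTo γ (Set.Icc 0 1) U →
      ∀ t ∈ Set.Icc (0 : ℝ) 1, eVariationOn γ (Set.Icc 0 t) < ENNReal.ofReal (k * h) →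
      ∃ c ∈ F, dist (γ t) c < h := by
  classical
  have hC' : ∀ c : M, ∃ G : Finset M, c ∈ U → ↑G ⊆ U ∧ G.card ≤ C ∧
      ∀ z ∈ U, dist z c < 2 * h → ∃ y ∈ G, dist z y < h := by
    intro c
    by_cases hc : c ∈ U
    · obtain ⟨G, hG⟩ := hC c hc
      exact ⟨G, fun _ => hG⟩
    · exact ⟨∅, fun h => absurd h hc⟩
  choose G hG using hC'
  induction k with
  | zero => exact ⟨∅, by simp, by simp, by simp⟩
  | succ k ih =>
    obtain ⟨F, hFU, hFc, hF⟩ := ih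
    refine ⟨insert p (F.biUnion G), ?_, ?_, ?_⟩
    · intro y hy
      rcases Finset.mem_insert.1 (Finset.mem_coe.1 hy) with rfl | hy
      · exact hp
      · obtain ⟨c, hc, hy⟩ := Finset.mem_biUnion.1 hy
        exact (hG c (hFU hc)).1 hy
    · have h1 : (F.biUnion G).card ≤ F.card * C :=
        Finset.card_biUnion_le_card_mul _ _ _ fun c hc => (hG c (hFU hc)).2.1
      have h2 := Finset.card_insert_le p (F.biUnion G)
      have h3 : F.card * C ≤ (1 + C) ^ k * C := Nat.mul_le_mul_right _ hFc
      have h4 : 1 ≤ (1 + C) ^ k := Nat.one_le_pow _ _ (by omega)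
      rw [pow_succ, mul_add]
      omega
    · intro γ hγ h0 hmaps t ht hv
      by_cases hd : dist (γ t) (γ 0) < h
      · exact ⟨p, Finset.mem_insert_self _ _, h0 ▸ hd⟩
      push Not at hd
      have hcont : ContinuousOn (fun s => dist (γ t) (γ s)) (Set.Icc 0 t) :=
        (continuous_const.dist continuous_id).comp_continuousOn (hγ.mono (Set.Icc_subset_Icc_right ht.2))
      obtain ⟨s, hs, hsd⟩ : h ∈ (fun s => dist (γ t) (γ s)) '' Set.Icc 0 t :=
        intermediate_value_Icc' ht.1 hcont ⟨by simpa using hh.le, hd⟩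
      have hsd' : dist (γ t) (γ s) = h := hsd
      have hadd := eVariationOn.Icc_add_Icc γ (s := Set.univ) hs.1 hs.2 (Set.mem_univ _)
      simp only [Set.univ_inter] at hadd
      have he : ENNReal.ofReal h ≤ eVariationOn γ (Set.Icc s t) := by
        rw [← hsd', ← edist_dist]
        exact eVariationOn.edist_le γ (Set.right_mem_Icc.2 hs.2) (Set.left_mem_Icc.2 hs.2)
      have hvs : eVariationOn γ (Set.Icc 0 s) < ENNReal.ofReal (k * h) := by
        by_contra hcon
        push Not at hcon
        refine absurd hv (not_lt.2 ?_)
        rw [← hadd]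
        calc ENNReal.ofReal (((k + 1 : ℕ) : ℝ) * h)
            = ENNReal.ofReal (k * h) + ENNReal.ofReal h := by
              rw [← ENNReal.ofReal_add (by positivity) hh.le]; push_cast; ring_nf
          _ ≤ _ := add_le_add hcon he
      obtain ⟨c, hc, hcd⟩ := hF γ hγ h0 hmaps s ⟨hs.1, hs.2.trans ht.2⟩ hvs
      obtain ⟨y, hy, hyd⟩ := (hG c (hFU hc)).2.2 (γ t) (hmaps ht)
        (by linarith [dist_triangle (γ t) (γ s) c])
      exact ⟨y, Finset.mem_insert_of_mem (Finset.mem_biUnion.2 ⟨c, hc, hy⟩), hyd⟩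

lemma aux_main (r₀ : ℝ) (hr₀ : 0 < r₀) (A₀ : ℝ≥0) (hA₀ : 1 ≤ A₀) (r : ℝ) (hr : 0 < r)
    (hrr : r ≤ r₀) : ∃ N : ℝ → ℝ → ℕ,
      ∀ (M : Type) [MetricSpace M] [MeasurableSpace M] [BorelSpace M]
        (μ : Measure M) (Y : Set M) (p : M),
        IsLengthSpace M → p ∈ Y →
        DoublingAlong μ Y r₀ A₀ →
        ∀ R ε : ℝ, 0 < R → 0 < ε →
          ∃ F : Finset M, ↑F ⊆ Y ∧ F.card ≤ N R ε ∧
            ∀ x ∈ Y,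
              lengthEDistIn {z : M | ∃ y ∈ Y, dist z y < r} p x < ENNReal.ofReal R →
              ∃ y' ∈ F,
                lengthEDistIn {z : M | ∃ y ∈ Y, dist z y < r} x y' < ENNReal.ofReal ε := by
  classical
  have hpk : ∀ δ : ℝ, ∃ C : ℕ, 0 < δ → _ := fun δ => by
    by_cases hδ : 0 < δ
    · obtain ⟨C, hC⟩ := aux_pack r₀ hr₀ A₀ hA₀ δ hδ
      exact ⟨C, fun _ => hC⟩
    · exact ⟨0, fun h => absurd h hδ⟩
  choose C hC using hpk
  have net : ∀ (δ : ℝ), 0 < δ → ∀ (M : Type) [MetricSpace M] [MeasurableSpace M] [BorelSpace M]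
      (μ : Measure M) (Y : Set M), DoublingAlong μ Y r₀ A₀ →
      ∀ x : M, (∃ w ∈ Y, dist x w < r₀) → ∀ S : Set M,
        (∀ z ∈ S, (∃ w ∈ Y, dist z w < r₀) ∧ dist z x < r₀ / 4) →
        ∃ F : Finset M, ↑F ⊆ S ∧ F.card ≤ C δ ∧ ∀ x ∈ S, ∃ y ∈ F, dist x y < δ := by
    intro δ hδ M _ _ _ μ Y hμ x hx S hS
    exact aux_net S δ hδ (C δ) fun F hFS hsep =>
      hC δ hδ M μ Y hμ x hx F (fun z hz => hS z (hFS hz)) hsep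
  refine ⟨fun R ε => (1 + C (r₀ / 8)) ^ ⌈R / (r₀ / 8)⌉₊ * C (min ε r), ?_⟩
  intro M _ _ _ μ Y p hM hp hμ R ε hR hε
  set U : Set M := {z : M | ∃ y ∈ Y, dist z y < r} with hU
  have hUr : ∀ z ∈ U, ∃ w ∈ Y, dist z w < r₀ := by
    rintro z ⟨w, hw, hd⟩
    exact ⟨w, hw, hd.trans_le hrr⟩
  have hYU : Y ⊆ U := fun y hy => ⟨y, hy, by simpa using hr⟩
  have hh : 0 < r₀ / 8 := by positivity
  obtain ⟨F, hFU, hFc, hF⟩ := aux_chain U (r₀ / 8) hh (C (r₀ / 8)) p (hYU hp) (by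
    intro c hc
    obtain ⟨G, hG1, hG2, hG3⟩ := net (r₀ / 8) hh M μ Y hμ c (hUr c hc)
      {z | z ∈ U ∧ dist z c < 2 * (r₀ / 8)}
      (fun z hz => ⟨hUr z hz.1, by linarith [hz.2]⟩)
    exact ⟨G, fun z hz => (hG1 hz).1, hG2, fun z hz hd => hG3 z ⟨hz, hd⟩⟩) ⌈R / (r₀ / 8)⌉₊
  have hm : 0 < min ε r := lt_min hε hr
  have hloc : ∀ c : M, ∃ G : Finset M, c ∈ U → ↑G ⊆ Y ∧ G.card ≤ C (min ε r) ∧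
      ∀ z ∈ Y, dist z c < r₀ / 8 → ∃ y ∈ G, dist z y < min ε r := by
    intro c
    by_cases hc : c ∈ U
    · obtain ⟨G, hG1, hG2, hG3⟩ := net (min ε r) hm M μ Y hμ c (hUr c hc)
        {z | z ∈ Y ∧ dist z c < r₀ / 8}
        (fun z hz => ⟨hUr z (hYU hz.1), by linarith [hz.2]⟩)
      exact ⟨G, fun _ => ⟨fun z hz => (hG1 hz).1, hG2, fun z hz hd => hG3 z ⟨hz, hd⟩⟩⟩
    · exact ⟨∅, fun h => absurd h hc⟩
  choose G hG using hloc
  refine ⟨F.biUnion G, ?_, ?_, ?_⟩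
  · intro y hy
    obtain ⟨c, hc, hy⟩ := Finset.mem_biUnion.1 (Finset.mem_coe.1 hy)
    exact (hG c (hFU hc)).1 hy
  · exact (Finset.card_biUnion_le_card_mul _ _ _ fun c hc => (hG c (hFU hc)).2.1).trans
      (Nat.mul_le_mul_right _ hFc)
  · intro x hx hd
    obtain ⟨γ, hγ, h0, h1, hmaps, hv⟩ := aux_path hd
    have hRk : R ≤ (⌈R / (r₀ / 8)⌉₊ : ℝ) * (r₀ / 8) := by
      rw [← div_le_iff₀ hh]; exact Nat.le_ceil _
    obtain ⟨c, hc, hcd⟩ := hF γ hγ h0 hmaps 1 (by simp)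
      (hv.trans_le (ENNReal.ofReal_le_ofReal hRk))
    rw [h1] at hcd
    obtain ⟨y, hy, hyd⟩ := (hG c (hFU hc)).2.2 x hx hcd
    exact ⟨y, Finset.mem_biUnion.2 ⟨c, hc, hy⟩, aux_local hM Y r ε hx hyd⟩

/-- The paper's corollary on `r`-extrinsic metrics (metric-measure form): connected
subsets `Y` of length spaces, whose `r₀`-neighborhood has complete closure and which
carry a measure `(r₀, A₀)`-doubling along `Y`, equipped with the `r`-extrinsic metric
(the restriction to `Y` of the induced length metric of `B_r(Y, M)`), form a uniformly
totally bounded — hence pointed Gromov–Hausdorff precompact — family: (1) for every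
`0 < r < r₀`; (2) for `r = r₀`, provided `diam (Y, d_Y) ≤ D`. -/
theorem extrinsic_metric_uniformly_totallyBounded
    (r₀ : ℝ) (hr₀ : 0 < r₀) (A₀ : ℝ≥0) (hA₀ : 1 ≤ A₀) :
    (∀ r : ℝ, 0 < r → r < r₀ → ∃ N : ℝ → ℝ → ℕ,
      ∀ (M : Type) [MetricSpace M] [MeasurableSpace M] [BorelSpace M]
        (μ : Measure M) (Y : Set M) (p : M),
        IsLengthSpace M → IsConnected Y → p ∈ Y →
        IsComplete (closure {z : M | ∃ y ∈ Y, dist z y < r₀}) →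
        DoublingAlong μ Y r₀ A₀ →
        ∀ R ε : ℝ, 0 < R → 0 < ε →
          ∃ F : Finset M, ↑F ⊆ Y ∧ F.card ≤ N R ε ∧
            ∀ x ∈ Y,
              lengthEDistIn {z : M | ∃ y ∈ Y, dist z y < r} p x < ENNReal.ofReal R →
              ∃ y' ∈ F,
                lengthEDistIn {z : M | ∃ y ∈ Y, dist z y < r} x y' < ENNReal.ofReal ε) ∧
    (∀ D : ℝ, 0 < D → ∃ N : ℝ → ℝ → ℕ,
      ∀ (M : Type) [MetricSpace M] [MeasurableSpace M] [BorelSpace M]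
        (μ : Measure M) (Y : Set M) (p : M),
        IsLengthSpace M → IsConnected Y → p ∈ Y →
        IsComplete (closure {z : M | ∃ y ∈ Y, dist z y < r₀}) →
        DoublingAlong μ Y r₀ A₀ →
        (∀ x ∈ Y, ∀ y ∈ Y, lengthEDistIn Y x y ≤ ENNReal.ofReal D) →
        ∀ R ε : ℝ, 0 < R → 0 < ε →
          ∃ F : Finset M, ↑F ⊆ Y ∧ F.card ≤ N R ε ∧
            ∀ x ∈ Y,
              lengthEDistIn {z : M | ∃ y ∈ Y, dist z y < r₀} p x < ENNReal.ofReal R →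
              ∃ y' ∈ F,
                lengthEDistIn {z : M | ∃ y ∈ Y, dist z y < r₀} x y' < ENNReal.ofReal ε) := by
  refine ⟨fun r hr hrr => ?_, fun D _ => ?_⟩
  · obtain ⟨N, hN⟩ := aux_main r₀ hr₀ A₀ hA₀ r hr hrr.le
    exact ⟨N, fun M _ _ _ μ Y p hM _ hp _ hμ => hN M μ Y p hM hp hμ⟩
  · obtain ⟨N, hN⟩ := aux_main r₀ hr₀ A₀ hA₀ r₀ hr₀ le_rfl
    exact ⟨N, fun M _ _ _ μ Y p hM _ hp _ hμ _ => hN M μ Y p hM hp hμ⟩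
end
end

section
/- Fix A₀≥1. Let (Y_i,p_i) be a sequence of connected subsets with basepoints in length spaces (M_i,d_i), each M_i carrying a Borel measure μ_i, and suppose that r₁ := inf_i sup{ r>0 : the closure of B_r(Y_i,M_i) in M_i is complete, and μ_i is (r,A₀)-doubling along Y_i } > 0. Then for every 0<δ<2r₁, the family {(Y_i, d_{Y_i}^δ, p_i)}, each Y_i equipped with its δ-intrinsic metric, is uniformly totally bounded, hence precompact in the pointed Gromov–Hausdorff topology. -/
open Set Metric Filter MeasureTheory ENNReal NNReal

noncomputable section

/-- The `δ`-intrinsic (chain) extended distance on a subset `Y`: the infimum of the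
total lengths of chains in `Y` from `x` to `y` with steps of ambient distance `≤ δ`. -/
def chainEDist {M : Type*} [MetricSpace M] (Y : Set M) (δ : ℝ) (x y : M) : ℝ≥0∞ :=
  ⨅ (n : ℕ) (u : ℕ → M) (_ : u 0 = x) (_ : u n = y) (_ : ∀ k ≤ n, u k ∈ Y)
    (_ : ∀ k < n, dist (u k) (u (k + 1)) ≤ δ),
    ∑ k ∈ Finset.range n, edist (u k) (u (k + 1))

/-- Points reachable in `k` steps of size at most `σ` inside `W`. -/
def reachSet {X : Type*} [MetricSpace X] (W : Set X) (σ : ℝ) (x : X) : ℕ → Set X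
  | 0 => {x}
  | k + 1 => {y | y ∈ W ∧ ∃ z ∈ reachSet W σ x k, dist z y ≤ σ}

theorem reachSet_sub {X : Type*} [MetricSpace X] {W : Set X} {σ : ℝ} {x : X} (hx : x ∈ W)
    (k : ℕ) : reachSet W σ x k ⊆ W := by
  cases k with
  | zero => intro y hy; rw [reachSet, mem_singleton_iff] at hy; rwa [hy]
  | succ k => intro y hy; exact hy.1

theorem reachSet_mono {X : Type*} [MetricSpace X] {W : Set X} {σ : ℝ} (hσ : 0 ≤ σ)
    {x : X} (hx : x ∈ W) {k l : ℕ} (h : k ≤ l) : reachSet W σ x k ⊆ reachSet W σ x l := by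
  induction l, h using Nat.le_induction with
  | base => exact subset_rfl
  | succ l _ ih =>
    intro y hy
    exact ⟨reachSet_sub hx _ hy, y, ih hy, by simpa using hσ⟩

theorem reachSet_add {X : Type*} [MetricSpace X] {W : Set X} {σ : ℝ} {x y z : X} {a b : ℕ}
    (h1 : y ∈ reachSet W σ x a) (h2 : z ∈ reachSet W σ y b) : z ∈ reachSet W σ x (a + b) := by
  induction b generalizing z with
  | zero => rw [reachSet, mem_singleton_iff] at h2; rw [h2]; exact h1
  | succ b ih =>
    obtain ⟨hz, w, hw, hd⟩ := h2
    exact ⟨hz, w, ih hw, hd⟩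

theorem merge_chain {X : Type*} [MetricSpace X] {W : Set X} {σ : ℝ} (u : ℕ → X) (n : ℕ)
    (hW : ∀ k ≤ n, u k ∈ W) (hd : ∀ k < n, dist (u k) (u (k + 1)) ≤ σ) (hσ : 0 ≤ σ) :
    ∃ k : ℕ, k * σ ≤ ∑ j ∈ Finset.range n, dist (u j) (u (j + 1)) ∧
      u n ∈ reachSet W σ (u 0) (2 * k + 1) := by
  suffices H : ∃ k : ℕ, ∃ z ∈ reachSet W σ (u 0) (2 * k), dist z (u n) ≤ σ ∧
      dist z (u n) + k * σ ≤ ∑ j ∈ Finset.range n, dist (u j) (u (j + 1)) by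
    obtain ⟨k, z, hz, h1, h2⟩ := H
    refine ⟨k, by linarith [dist_nonneg (x := z) (y := u n)], hW n le_rfl, z, hz, h1⟩
  induction n with
  | zero => exact ⟨0, u 0, by simp [reachSet], by simpa using hσ, by simp⟩
  | succ n ih =>
    obtain ⟨k, z, hz, h1, h2⟩ := ih (fun k hk => hW k (by omega)) (fun k hk => hd k (by omega))
    rw [Finset.sum_range_succ]
    by_cases hc : dist z (u n) + dist (u n) (u (n + 1)) ≤ σ
    · have := dist_triangle z (u n) (u (n + 1))
      exact ⟨k, z, hz, by linarith, by linarith⟩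
    · refine ⟨k + 1, u (n + 1), ?_, by simpa using hσ, ?_⟩
      · exact ⟨hW _ le_rfl, u n, ⟨hW n (by omega), z, hz, h1⟩, hd n (by omega)⟩
      · push_cast
        rw [dist_self]
        linarith

theorem merge_chain' {X : Type*} [MetricSpace X] {W : Set X} {σ L : ℝ} (u : ℕ → X) (n : ℕ)
    (hW : ∀ k ≤ n, u k ∈ W) (hd : ∀ k < n, dist (u k) (u (k + 1)) ≤ σ) (hσ : 0 < σ)
    (hL : ∑ j ∈ Finset.range n, edist (u j) (u (j + 1)) < ENNReal.ofReal L) :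
    u n ∈ reachSet W σ (u 0) (2 * ⌊L / σ⌋₊ + 1) := by
  obtain ⟨k, hk, h⟩ := merge_chain u n hW hd hσ.le
  refine reachSet_mono hσ.le (hW 0 (by omega)) ?_ h
  have : ∑ j ∈ Finset.range n, dist (u j) (u (j + 1)) < L := by
    simp only [edist_dist] at hL
    rw [← ENNReal.ofReal_sum_of_nonneg (fun _ _ => dist_nonneg)] at hL
    exact (ENNReal.ofReal_lt_ofReal_iff'.1 hL).1
  have : k ≤ ⌊L / σ⌋₊ := by
    apply Nat.le_floor
    rw [le_div_iff₀ hσ]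
    linarith
  omega

theorem path_reach {X : Type*} [MetricSpace X] (hX : IsLengthSpace X) {Y : Set X} {ρ σ : ℝ}
    (hσ : 0 < σ) {x y : X} (hx : x ∈ Y) (hy : y ∈ Y) (hxy : dist x y < 2 * ρ) :
    y ∈ reachSet {z | ∃ w ∈ Y, dist z w < ρ} σ x (2 * ⌊2 * ρ / σ⌋₊ + 1) := by
  have h0 : lengthEDistIn (Set.univ : Set X) x y < ENNReal.ofReal (2 * ρ) := by
    rw [← hX x y, edist_dist]
    exact (ENNReal.ofReal_lt_ofReal_iff (dist_nonneg.trans_lt hxy)).2 hxy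
  simp only [lengthEDistIn, iInf_lt_iff] at h0
  obtain ⟨γ, hγ, rfl, rfl, -, hV⟩ := h0
  have hU : ∀ t ∈ Icc (0:ℝ) 1, γ t ∈ {z | ∃ w ∈ Y, dist z w < ρ} := by
    intro t ht
    have h1 : edist (γ 0) (γ t) + edist (γ t) (γ 1) < ENNReal.ofReal (2 * ρ) := by
      refine lt_of_le_of_lt ?_ hV
      have hadd := eVariationOn.Icc_add_Icc γ (s := Icc 0 1) ht.1 ht.2 ht
      rw [inter_self] at hadd
      rw [← hadd]
      gcongr
      · exact eVariationOn.edist_le _ ⟨by simp, le_rfl, ht.1⟩ ⟨ht, ht.1, le_rfl⟩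
      · exact eVariationOn.edist_le _ ⟨ht, le_rfl, ht.2⟩ ⟨by simp, ht.2, le_rfl⟩
    rw [edist_dist, edist_dist, ← ENNReal.ofReal_add dist_nonneg dist_nonneg] at h1
    have h2 := (ENNReal.ofReal_lt_ofReal_iff'.1 h1).1
    by_contra hc
    simp only [mem_ofPred_eq, not_exists, not_and, not_lt] at hc
    have h3 := hc _ hx
    have h4 := hc _ hy
    rw [dist_comm] at h3
    linarith
  have huc := isCompact_Icc.uniformContinuousOn_of_continuous hγ
  rw [Metric.uniformContinuousOn_iff] at huc
  obtain ⟨η, hη, huc⟩ := huc σ hσ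
  obtain ⟨n, hn⟩ := exists_nat_one_div_lt hη
  have hn0 : (0:ℝ) < (n:ℝ) + 1 := by positivity
  set t : ℕ → ℝ := fun k => min ((k:ℝ) / (n + 1)) 1 with ht
  have htm : ∀ k, t k ∈ Icc (0:ℝ) 1 := fun k => ⟨le_min (by positivity) zero_le_one, min_le_right _ _⟩
  have hmono : Monotone t := by
    intro a b hab
    simp only [ht]
    gcongr
  have e0 : t 0 = 0 := by simp [ht]
  have e1 : t (n + 1) = 1 := by simp [ht, div_self hn0.ne']
  have key := merge_chain' (W := {z | ∃ w ∈ Y, dist z w < ρ}) (σ := σ) (L := 2 * ρ)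
    (fun k => γ (t k)) (n + 1) (fun k _ => hU _ (htm k)) ?_ hσ ?_
  · simpa only [e0, e1] using key
  · intro k hk
    refine (huc _ (htm _) _ (htm _) ?_).le
    have hk1 : ((k:ℝ) + 1) / (n + 1) ≤ 1 := by
      rw [div_le_one hn0]; exact_mod_cast hk
    have hk0 : (k:ℝ) / (n + 1) ≤ 1 := le_trans (by gcongr; linarith) hk1
    have a1 : t k = (k:ℝ) / (n + 1) := min_eq_left hk0
    have a2 : t (k + 1) = ((k:ℝ) + 1) / (n + 1) := by
      simp only [ht]; push_cast; exact min_eq_left hk1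
    rw [a1, a2, dist_comm, Real.dist_eq, ← _root_.sub_div, add_sub_cancel_left, abs_of_pos (by positivity)]
    exact hn
  · refine lt_of_le_of_lt ?_ hV
    simp only [edist_comm (γ (t _)) (γ (t (_ + 1)))]
    exact eVariationOn.sum_le hmono htm

theorem exists_net {X : Type*} [MetricSpace X] (T : Set X) (η : ℝ) (N : ℕ)
    (h : ∀ F : Finset X, ↑F ⊆ T → (∀ x ∈ F, ∀ y ∈ F, x ≠ y → η ≤ dist x y) → F.card ≤ N)
    (hη : 0 < η) :
    ∃ F : Finset X, ↑F ⊆ T ∧ F.card ≤ N ∧ ∀ x ∈ T, ∃ y ∈ F, dist x y < η := by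
  classical
  set S : Set ℕ := {n | ∃ F : Finset X, ↑F ⊆ T ∧
    (∀ x ∈ F, ∀ y ∈ F, x ≠ y → η ≤ dist x y) ∧ F.card = n} with hS
  have hb : BddAbove S := ⟨N, by rintro n ⟨F, h1, h2, rfl⟩; exact h F h1 h2⟩
  have hne : S.Nonempty := ⟨0, ∅, by simp, by simp, rfl⟩
  obtain ⟨F, h1, h2, h3⟩ := Nat.sSup_mem hne hb
  refine ⟨F, h1, h F h1 h2, fun x hx => ?_⟩
  by_contra! hc
  have hxF : x ∉ F := fun hxF => by
    have := hc x hxF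
    rw [dist_self] at this
    linarith
  have : F.card + 1 ∈ S := by
    refine ⟨insert x F, ?_, ?_, Finset.card_insert_of_notMem hxF⟩
    · rw [Finset.coe_insert]; exact insert_subset hx h1
    · intro a ha b hb hab
      rw [Finset.mem_insert] at ha hb
      rcases ha with rfl | ha <;> rcases hb with rfl | hb
      · exact absurd rfl hab
      · exact hc b hb
      · rw [dist_comm]; exact hc a ha
      · exact h2 a ha b hb hab
  have := le_csSup hb this
  omega

/-- A dyadic exponent with `ρ / 2^k ≤ η / 2`. -/
theorem exists_exponent (ρ η : ℝ) (hρ : 0 < ρ) (hη : 0 < η) :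
    ∃ k : ℕ, ρ / 2 ^ k ≤ η / 2 ∧ ρ / 2 ^ k ≤ ρ / 2 := by
  obtain ⟨k, hk⟩ := pow_unbounded_of_one_lt (2 * ρ / η) (one_lt_two (α := ℝ))
  refine ⟨k + 1, ?_, ?_⟩
  · rw [div_lt_iff₀ hη] at hk
    rw [div_le_div_iff₀ (by positivity) two_pos, pow_succ]
    nlinarith [pow_pos (two_pos (α := ℝ)) k]
  · have : (1:ℝ) ≤ 2 ^ k := one_le_pow₀ one_le_two
    apply div_le_div_of_nonneg_left hρ.le two_pos
    rw [pow_succ]; linarith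

theorem doubling_iter {X : Type*} [MetricSpace X] [MeasurableSpace X]
    {μ : Measure X} {Y : Set X} {ρ : ℝ} {A : ℝ≥0} (hρ : 0 < ρ) (hD : DoublingAlong μ Y ρ A)
    {z : X} (hz : ∃ w ∈ Y, dist z w < ρ) (k : ℕ) :
    μ (ball z ρ) ≤ (A : ℝ≥0∞) ^ k * μ (ball z (ρ / 2 ^ k)) := by
  induction k with
  | zero => simp
  | succ k ih =>
    refine ih.trans ?_
    rw [pow_succ, mul_assoc]
    gcongr
    have : ρ / 2 ^ (k + 1) = ρ / 2 ^ k / 2 := by rw [pow_succ, div_div]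
    rw [this]
    exact (hD z hz _ (by positivity) (div_le_self hρ.le (one_le_pow₀ one_le_two))).2.1

theorem packing_bound {X : Type*} [MetricSpace X] [MeasurableSpace X] [BorelSpace X]
    {μ : Measure X} {Y : Set X} {ρ : ℝ} {A : ℝ≥0} (hρ : 0 < ρ) (hD : DoublingAlong μ Y ρ A)
    {η : ℝ} {k : ℕ} (hk1 : ρ / 2 ^ k ≤ η / 2) (hk2 : ρ / 2 ^ k ≤ ρ / 2)
    {y : X} (hy : ∃ w ∈ Y, dist y w < ρ) (F : Finset X)
    (hF : ∀ z ∈ F, (∃ w ∈ Y, dist z w < ρ) ∧ dist z y ≤ ρ / 4)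
    (hs : ∀ x ∈ F, ∀ y ∈ F, x ≠ y → η ≤ dist x y) : F.card ≤ ⌊A ^ (k + 1)⌋₊ := by
  have hpos := (hD y hy ρ hρ le_rfl).1
  have hfin : μ (ball y ρ) < ⊤ := (hD y hy ρ hρ le_rfl).2.1.trans_lt (hD y hy ρ hρ le_rfl).2.2
  have hdisj : (F : Set X).PairwiseDisjoint (fun z => ball z (ρ / 2 ^ k)) := by
    intro a ha b hb hab
    apply ball_disjoint_ball
    have := hs a ha b hb hab
    linarith
  have h1 : ∑ z ∈ F, μ (ball z (ρ / 2 ^ k)) ≤ μ (ball y ρ) := by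
    rw [← measure_biUnion_finset hdisj (fun z _ => measurableSet_ball)]
    apply measure_mono
    refine iUnion₂_subset fun z hz => ball_subset_ball' ?_
    have := (hF z hz).2
    linarith
  have h2 : ∀ z ∈ F, μ (ball y ρ) ≤ (A : ℝ≥0∞) ^ (k + 1) * μ (ball z (ρ / 2 ^ k)) := by
    intro z hz
    calc μ (ball y ρ) ≤ A * μ (ball y (ρ / 2)) := (hD y hy ρ hρ le_rfl).2.1
      _ ≤ A * μ (ball z ρ) := by
        gcongr
        apply ball_subset_ball'
        have := (hF z hz).2
        rw [dist_comm] at this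
        linarith
      _ ≤ A * ((A : ℝ≥0∞) ^ k * μ (ball z (ρ / 2 ^ k))) := by
        gcongr
        exact doubling_iter hρ hD (hF z hz).1 k
      _ = _ := by rw [pow_succ]; ring
  have h3 : (F.card : ℝ≥0∞) * μ (ball y ρ) ≤ (A : ℝ≥0∞) ^ (k + 1) * μ (ball y ρ) := by
    calc (F.card : ℝ≥0∞) * μ (ball y ρ) = ∑ z ∈ F, μ (ball y ρ) := by simp
      _ ≤ ∑ z ∈ F, (A : ℝ≥0∞) ^ (k + 1) * μ (ball z (ρ / 2 ^ k)) := Finset.sum_le_sum h2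
      _ = (A : ℝ≥0∞) ^ (k + 1) * ∑ z ∈ F, μ (ball z (ρ / 2 ^ k)) := by rw [Finset.mul_sum]
      _ ≤ _ := by gcongr
  have h4 : (F.card : ℝ≥0∞) ≤ (A : ℝ≥0∞) ^ (k + 1) :=
    (ENNReal.mul_le_mul_iff_left hpos.ne' hfin.ne).1 h3
  apply Nat.le_floor
  exact_mod_cast h4

theorem refine_net {X : Type*} [MetricSpace X] [MeasurableSpace X] [BorelSpace X]
    {μ : Measure X} {Y : Set X} {ρ : ℝ} {A : ℝ≥0} (hρ : 0 < ρ) (hD : DoublingAlong μ Y ρ A)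
    {η : ℝ} (hη : 0 < η) {k : ℕ} (hk1 : ρ / 2 ^ k ≤ η / 2) (hk2 : ρ / 2 ^ k ≤ ρ / 2)
    (F : Finset X) (T : Set X) (hF : ↑F ⊆ {z | ∃ w ∈ Y, dist z w < ρ})
    (hT : T ⊆ {z | ∃ w ∈ Y, dist z w < ρ})
    (hc : ∀ x ∈ T, ∃ y ∈ F, dist x y ≤ ρ / 4) :
    ∃ G : Finset X, ↑G ⊆ T ∧ G.card ≤ F.card * ⌊A ^ (k + 1)⌋₊ ∧
      ∀ x ∈ T, ∃ y ∈ G, dist x y < η := by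
  classical
  have H : ∀ y : X, y ∈ F → ∃ G : Finset X, ↑G ⊆ T ∩ closedBall y (ρ / 4) ∧
      G.card ≤ ⌊A ^ (k + 1)⌋₊ ∧ ∀ x ∈ T ∩ closedBall y (ρ / 4), ∃ y ∈ G, dist x y < η := by
    intro y hy
    refine exists_net _ _ _ (fun G hG hs => ?_) hη
    exact packing_bound hρ hD hk1 hk2 (hF hy) G
      (fun z hz => ⟨hT (hG hz).1, mem_closedBall.1 (hG hz).2⟩) hs
  choose! G hG1 hG2 hG3 using H
  refine ⟨F.biUnion G, ?_, Finset.card_biUnion_le_card_mul _ _ _ hG2, ?_⟩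
  · intro z hz
    rw [Finset.mem_coe, Finset.mem_biUnion] at hz
    obtain ⟨y, hy, hz⟩ := hz
    exact (hG1 y hy hz).1
  · intro x hx
    obtain ⟨y, hy, hxy⟩ := hc x hx
    obtain ⟨w, hw, hxw⟩ := hG3 y hy x ⟨hx, mem_closedBall.2 hxy⟩
    exact ⟨w, Finset.mem_biUnion.2 ⟨y, hy, hw⟩, hxw⟩

theorem reach_net {X : Type*} [MetricSpace X] [MeasurableSpace X] [BorelSpace X]
    {μ : Measure X} {Y : Set X} {ρ : ℝ} {A : ℝ≥0} (hρ : 0 < ρ) (hD : DoublingAlong μ Y ρ A)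
    {k : ℕ} (hk1 : ρ / 2 ^ k ≤ (ρ / 8) / 2) (hk2 : ρ / 2 ^ k ≤ ρ / 2)
    {p : X} (hp : p ∈ Y) (K : ℕ) :
    ∃ G : Finset X, ↑G ⊆ {z | ∃ w ∈ Y, dist z w < ρ} ∧ G.card ≤ ⌊A ^ (k + 1)⌋₊ ^ K ∧
      ∀ x ∈ reachSet {z | ∃ w ∈ Y, dist z w < ρ} (ρ / 8) p K, ∃ y ∈ G, dist x y < ρ / 8 := by
  have hpU : p ∈ {z | ∃ w ∈ Y, dist z w < ρ} := ⟨p, hp, by simpa using hρ⟩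
  induction K with
  | zero =>
    refine ⟨{p}, by simpa using hpU, by simp, fun x hx => ⟨p, by simp, ?_⟩⟩
    rw [reachSet, mem_singleton_iff] at hx
    rw [hx, dist_self]; positivity
  | succ K ih =>
    obtain ⟨F, hF1, hF2, hF3⟩ := ih
    obtain ⟨G, hG1, hG2, hG3⟩ := refine_net hρ hD (η := ρ / 8) (by positivity) hk1 hk2 F
      (reachSet {z | ∃ w ∈ Y, dist z w < ρ} (ρ / 8) p (K + 1)) hF1 (reachSet_sub hpU _) (by
        rintro x ⟨_, z, hz, hzx⟩
        obtain ⟨y, hy, hzy⟩ := hF3 z hz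
        refine ⟨y, hy, ?_⟩
        have := dist_triangle_left x y z
        linarith)
    refine ⟨G, hG1.trans (reachSet_sub hpU _), hG2.trans ?_, hG3⟩
    rw [pow_succ]
    exact Nat.mul_le_mul_right _ hF2

theorem chainEDist_le_edist {X : Type*} [MetricSpace X] {Y : Set X} {δ : ℝ} {x y : X}
    (hx : x ∈ Y) (hy : y ∈ Y) (h : dist x y ≤ δ) : chainEDist Y δ x y ≤ edist x y := by
  unfold chainEDist
  refine iInf_le_of_le 1 <| iInf_le_of_le (fun k => if k = 0 then x else y) <|
    iInf_le_of_le (by simp) <| iInf_le_of_le (by simp) <| iInf_le_of_le ?_ <|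
    iInf_le_of_le ?_ ?_
  · intro k _
    dsimp only
    split_ifs <;> assumption
  · intro k hk
    obtain rfl : k = 0 := by omega
    simpa using h
  · simp

theorem reach_reach {X : Type*} [MetricSpace X] (hX : IsLengthSpace X) {Y : Set X} {ρ σ δ : ℝ}
    (hσ : 0 < σ) (hδ : δ < 2 * ρ) {p : X} (hp : p ∈ Y) (K : ℕ) :
    reachSet Y δ p K ⊆
      reachSet {z | ∃ w ∈ Y, dist z w < ρ} σ p (K * (2 * ⌊2 * ρ / σ⌋₊ + 1)) := by
  induction K with
  | zero => rw [zero_mul]; exact subset_rfl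
  | succ K ih =>
    rintro y ⟨hy, z, hz, hzy⟩
    rw [Nat.succ_mul]
    exact reachSet_add (ih hz) (path_reach hX hσ (reachSet_sub hp _ hz) hy (hzy.trans_lt hδ))

/-- The paper's corollary on `δ`-intrinsic metrics (metric-measure form): for a
sequence of connected subsets `Y i` of length spaces `M i` with
`r₁ = inf_i sup {r : closure (B_r(Y i)) complete and μ i is (r, A₀)-doubling along Y i} > 0`,
for every `0 < δ < 2 r₁` the family `{(Y i, d_{Y i}^δ, p i)}` with the `δ`-intrinsic
metrics is uniformly totally bounded, hence pointed Gromov–Hausdorff precompact. -/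
theorem delta_intrinsic_uniformly_totallyBounded (A₀ : ℝ≥0) (hA₀ : 1 ≤ A₀)
    (M : ℕ → Type) [∀ i, MetricSpace (M i)] [∀ i, MeasurableSpace (M i)]
    [∀ i, BorelSpace (M i)] (μ : ∀ i, Measure (M i))
    (Y : ∀ i, Set (M i)) (p : ∀ i, M i)
    (hlen : ∀ i, IsLengthSpace (M i)) (hconn : ∀ i, IsConnected (Y i))
    (hp : ∀ i, p i ∈ Y i) (r₁ : ℝ) (hr₁ : 0 < r₁)
    (hgood : ∀ (i : ℕ) (ρ : ℝ), 0 < ρ → ρ < r₁ →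
      IsComplete (closure {z : M i | ∃ y ∈ Y i, dist z y < ρ}) ∧
      DoublingAlong (μ i) (Y i) ρ A₀) :
    ∀ δ : ℝ, 0 < δ → δ < 2 * r₁ →
      ∃ N : ℝ → ℝ → ℕ, ∀ (i : ℕ) (R ε : ℝ), 0 < R → 0 < ε →
        ∃ F : Finset (M i), ↑F ⊆ Y i ∧ F.card ≤ N R ε ∧
          ∀ x ∈ Y i, chainEDist (Y i) δ (p i) x < ENNReal.ofReal R →
            ∃ y ∈ F, chainEDist (Y i) δ x y < ENNReal.ofReal ε := by
  intro δ hδ0 hδ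
  obtain ⟨ρ, hρ1, hρ2⟩ := exists_between (show δ / 2 < r₁ by linarith)
  have hρ : 0 < ρ := by linarith
  have hδρ : δ < 2 * ρ := by linarith
  obtain ⟨k₀, hk₀, hk₀'⟩ := exists_exponent ρ (ρ / 8) hρ (by positivity)
  have hex : ∀ ε : ℝ, ∃ k : ℕ, 0 < ε → ρ / 2 ^ k ≤ (min ε δ) / 2 ∧ ρ / 2 ^ k ≤ ρ / 2 := by
    intro ε
    by_cases hε : 0 < ε
    · obtain ⟨k, hk⟩ := exists_exponent ρ (min ε δ) hρ (lt_min hε hδ0)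
      exact ⟨k, fun _ => hk⟩
    · exact ⟨0, fun h => absurd h hε⟩
  choose k hk using hex
  set K : ℝ → ℕ := fun R => (2 * ⌊R / δ⌋₊ + 1) * (2 * ⌊2 * ρ / (ρ / 8)⌋₊ + 1) with hK
  refine ⟨fun R ε => ⌊A₀ ^ (k₀ + 1)⌋₊ ^ (K R) * ⌊A₀ ^ (k ε + 1)⌋₊, fun i R ε hR hε => ?_⟩
  have hD := (hgood i ρ hρ hρ2).2
  obtain ⟨F, hF1, hF2, hF3⟩ := reach_net hρ hD hk₀ hk₀' (hp i) (K R)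
  have hYU : Y i ⊆ {z | ∃ w ∈ Y i, dist z w < ρ} := fun y hy => ⟨y, hy, by simpa using hρ⟩
  obtain ⟨G, hG1, hG2, hG3⟩ := refine_net hρ hD (η := min ε δ) (lt_min hε hδ0)
    (hk ε hε).1 (hk ε hε).2 F
    (Y i ∩ reachSet {z | ∃ w ∈ Y i, dist z w < ρ} (ρ / 8) (p i) (K R)) hF1
    (inter_subset_left.trans hYU) (by
      rintro x ⟨_, hx⟩
      obtain ⟨y, hy, hxy⟩ := hF3 x hx
      exact ⟨y, hy, by linarith⟩)
  refine ⟨G, hG1.trans inter_subset_left, hG2.trans (Nat.mul_le_mul_right _ hF2), fun x hx hlt => ?_⟩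
  simp only [chainEDist, iInf_lt_iff] at hlt
  obtain ⟨n, u, hu0, hun, huY, hud, hsum⟩ := hlt
  have hr := merge_chain' u n huY hud hδ0 hsum
  rw [hu0, hun] at hr
  have hr' := reach_reach (hlen i) (σ := ρ / 8) (by positivity) hδρ (hp i) _ hr
  obtain ⟨y, hy, hxy⟩ := hG3 x ⟨hx, hr'⟩
  refine ⟨y, hy, ?_⟩
  refine (chainEDist_le_edist hx (hG1 hy).1 (hxy.le.trans (min_le_right _ _))).trans_lt ?_
  rw [edist_dist]
  exact (ENNReal.ofReal_lt_ofReal_iff hε).2 (hxy.trans_le (min_le_left _ _))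
end
end
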